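/- arXiv:1806.04109 — 10 statements merged into one kernel-verified Lean document; each statement's English description precedes it below -/
import Mathlib

section
/- Let (P_ℓ)_{ℓ∈ℤ} be a resolution of the identity on a complex Hilbert space H, and let (X_{jℓ})_{j,ℓ∈ℤ} be a family of bounded operators on H such that P_j ∘ X_{jℓ} ∘ P_ℓ = X_{jℓ} for all j, ℓ ∈ ℤ and ∑_{j,ℓ∈ℤ} ‖X_{jℓ}‖² < ∞. Then there exists a unique bounded operator X on H with P_j ∘ X ∘ P_ℓ = X_{jℓ} for all j, ℓ ∈ ℤ, and its operator norm satisfies ‖X‖ ≤ (∑_{j,ℓ∈ℤ} ‖X_{jℓ}‖²)^{1/2}. -/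
section BlockOperators

variable {ι H : Type*} [NormedAddCommGroup H] [InnerProductSpace ℂ H] [CompleteSpace H]
  {P : ι → H →L[ℂ] H}

/-- Bessel's inequality for a resolution of the identity by orthogonal projections. -/
theorem sum_norm_sq_apply_le (hP_sa : ∀ ℓ, IsSelfAdjoint (P ℓ)) (hP_idem : ∀ ℓ, P ℓ * P ℓ = P ℓ)
    (hP_sum : ∀ x : H, HasSum (fun ℓ => P ℓ x) x) (s : Finset ι) (x : H) :
    ∑ ℓ ∈ s, ‖P ℓ x‖ ^ 2 ≤ ‖x‖ ^ 2 := by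
  have key (ℓ : ι) : ‖P ℓ x‖ ^ 2 = RCLike.re (inner ℂ x (P ℓ x)) := by
    have h : inner ℂ (P ℓ x) (P ℓ x) = inner ℂ x (P ℓ (P ℓ x)) := (hP_sa ℓ).isSymmetric x (P ℓ x)
    rw [← inner_self_eq_norm_sq (𝕜 := ℂ), h, ← mul_apply_eq_comp, hP_idem]
  have hsum : HasSum (fun ℓ => ‖P ℓ x‖ ^ 2) (‖x‖ ^ 2) := by
    simp_rw [key, ← inner_self_eq_norm_sq (𝕜 := ℂ) x]
    exact RCLike.hasSum_re ℂ ((hP_sum x).mapL (innerSL ℂ x))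
  exact sum_le_hasSum s (fun _ _ => sq_nonneg _) hsum

/-- The operator norm of a finite sum of blocks is at most the ℓ²-norm of the block norms. -/
theorem norm_sum_blocks_le (hP_sa : ∀ ℓ, IsSelfAdjoint (P ℓ)) (hP_idem : ∀ ℓ, P ℓ * P ℓ = P ℓ)
    (hP_sum : ∀ x : H, HasSum (fun ℓ => P ℓ x) x) {X : ι → ι → H →L[ℂ] H}
    (hX_block : ∀ j ℓ, P j * X j ℓ * P ℓ = X j ℓ) (s : Finset (ι × ι)) :
    ‖∑ p ∈ s, X p.1 p.2‖ ≤ √(∑ p ∈ s, ‖X p.1 p.2‖ ^ 2) := by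
  classical
  have bilin (x y : H) : ‖inner ℂ y ((∑ p ∈ s, X p.1 p.2) x)‖
      ≤ √(∑ p ∈ s, ‖X p.1 p.2‖ ^ 2) * (‖y‖ * ‖x‖) := by
    have hterm (p : ι × ι) : ‖inner ℂ y (X p.1 p.2 x)‖
        ≤ ‖X p.1 p.2‖ * (‖P p.1 y‖ * ‖P p.2 x‖) := by
      have h : inner ℂ y (X p.1 p.2 x) = inner ℂ (P p.1 y) (X p.1 p.2 (P p.2 x)) := by
        conv_lhs => rw [← hX_block]
        exact ((hP_sa p.1).isSymmetric y (X p.1 p.2 (P p.2 x))).symm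
      calc ‖inner ℂ y (X p.1 p.2 x)‖ ≤ ‖P p.1 y‖ * ‖X p.1 p.2 (P p.2 x)‖ :=
            h ▸ norm_inner_le_norm _ _
        _ ≤ ‖P p.1 y‖ * (‖X p.1 p.2‖ * ‖P p.2 x‖) := by
            gcongr
            exact ContinuousLinearMap.le_opNorm _ _
        _ = _ := by ring
    have hprod : ∑ p ∈ s, (‖P p.1 y‖ * ‖P p.2 x‖) ^ 2 ≤ (‖y‖ * ‖x‖) ^ 2 := by
      calc ∑ p ∈ s, (‖P p.1 y‖ * ‖P p.2 x‖) ^ 2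
          ≤ ∑ p ∈ s.image Prod.fst ×ˢ s.image Prod.snd, (‖P p.1 y‖ * ‖P p.2 x‖) ^ 2 :=
            Finset.sum_le_sum_of_subset_of_nonneg Finset.subset_product
              fun _ _ _ => sq_nonneg _
        _ = (∑ j ∈ s.image Prod.fst, ‖P j y‖ ^ 2) * ∑ ℓ ∈ s.image Prod.snd, ‖P ℓ x‖ ^ 2 := by
            simp_rw [Finset.sum_mul_sum, Finset.sum_product, mul_pow]
        _ ≤ ‖y‖ ^ 2 * ‖x‖ ^ 2 := by
            gcongr
            · exact sum_norm_sq_apply_le hP_sa hP_idem hP_sum _ y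
            · exact sum_norm_sq_apply_le hP_sa hP_idem hP_sum _ x
        _ = _ := (mul_pow _ _ _).symm
    rw [sum_apply, inner_sum]
    calc ‖∑ p ∈ s, inner ℂ y (X p.1 p.2 x)‖
        ≤ ∑ p ∈ s, ‖X p.1 p.2‖ * (‖P p.1 y‖ * ‖P p.2 x‖) :=
          norm_sum_le_of_le s fun p _ => hterm p
      _ ≤ √(∑ p ∈ s, ‖X p.1 p.2‖ ^ 2) * √(∑ p ∈ s, (‖P p.1 y‖ * ‖P p.2 x‖) ^ 2) :=
          Real.sum_mul_le_sqrt_mul_sqrt _ _ _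
      _ ≤ _ := by
          gcongr
          exact Real.sqrt_le_iff.2 ⟨by positivity, hprod⟩
  refine ContinuousLinearMap.opNorm_le_bound _ (Real.sqrt_nonneg _) fun x => ?_
  rcases (norm_nonneg ((∑ p ∈ s, X p.1 p.2) x)).eq_or_lt with h0 | hpos
  · rw [← h0]
    positivity
  · have h := bilin x ((∑ p ∈ s, X p.1 p.2) x)
    rw [inner_self_eq_norm_sq_to_K, norm_pow, RCLike.norm_ofReal, abs_norm] at h
    exact le_of_mul_le_mul_right (by linarith) hpos

/-- Blocks with square-summable operator norms are summable in operator norm. -/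
theorem summable_blocks (hP_sa : ∀ ℓ, IsSelfAdjoint (P ℓ)) (hP_idem : ∀ ℓ, P ℓ * P ℓ = P ℓ)
    (hP_sum : ∀ x : H, HasSum (fun ℓ => P ℓ x) x) {X : ι → ι → H →L[ℂ] H}
    (hX_block : ∀ j ℓ, P j * X j ℓ * P ℓ = X j ℓ)
    (hX_sq : Summable (fun p : ι × ι => ‖X p.1 p.2‖ ^ 2)) :
    Summable (fun p : ι × ι => X p.1 p.2) := by
  rw [summable_iff_vanishing_norm] at hX_sq ⊢
  intro ε hε
  obtain ⟨s, hs⟩ := hX_sq (ε ^ 2) (by positivity)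
  refine ⟨s, fun t ht => (norm_sum_blocks_le hP_sa hP_idem hP_sum hX_block t).trans_lt ?_⟩
  exact (Real.sqrt_lt' hε).2 ((le_abs_self _).trans_lt (hs t ht))

end BlockOperators

/-- An operator is determined by its blocks with respect to a resolution of the identity. -/
theorem eq_of_blocks_eq {ι H : Type*} [NormedAddCommGroup H] [InnerProductSpace ℂ H]
    {P : ι → H →L[ℂ] H} (hP_sum : ∀ x : H, HasSum (fun ℓ => P ℓ x) x) {Y Z : H →L[ℂ] H}
    (h : ∀ j ℓ, P j * Z * P ℓ = P j * Y * P ℓ) : Z = Y := by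
  have hcol (ℓ : ι) (x : H) : Z (P ℓ x) = Y (P ℓ x) := by
    refine (hP_sum (Z (P ℓ x))).unique ?_
    convert hP_sum (Y (P ℓ x)) using 2 with j
    exact DFunLike.congr_fun (h j ℓ) x
  ext x
  refine ((hP_sum x).mapL Z).unique ?_
  simp_rw [hcol]
  exact (hP_sum x).mapL Y

/-- blocks with square-summable operator norms determine a unique bounded
operator dominated by the block ℓ²-norm. -/
theorem stmt_0
    {H : Type*} [NormedAddCommGroup H] [InnerProductSpace ℂ H] [CompleteSpace H]
    (P : ℤ → H →L[ℂ] H)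
    (hP_sa : ∀ ℓ, IsSelfAdjoint (P ℓ))
    (hP_idem : ∀ ℓ, P ℓ * P ℓ = P ℓ)
    (hP_orth : ∀ j ℓ, j ≠ ℓ → P j * P ℓ = 0)
    (hP_sum : ∀ x : H, HasSum (fun ℓ => P ℓ x) x)
    (X : ℤ → ℤ → H →L[ℂ] H)
    (hX_block : ∀ j ℓ, P j * X j ℓ * P ℓ = X j ℓ)
    (hX_sq : Summable (fun p : ℤ × ℤ => ‖X p.1 p.2‖ ^ 2)) :
    ∃ Y : H →L[ℂ] H,
      (∀ j ℓ, P j * Y * P ℓ = X j ℓ) ∧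
      ‖Y‖ ≤ Real.sqrt (∑' p : ℤ × ℤ, ‖X p.1 p.2‖ ^ 2) ∧
      ∀ Z : H →L[ℂ] H, (∀ j ℓ, P j * Z * P ℓ = X j ℓ) → Z = Y := by
  have hsum := (summable_blocks hP_sa hP_idem hP_sum hX_block hX_sq).hasSum
  set Y := ∑' p : ℤ × ℤ, X p.1 p.2
  have hY (j ℓ : ℤ) : P j * Y * P ℓ = X j ℓ := by
    refine ((hsum.mul_left (P j)).mul_right (P ℓ)).unique ?_
    convert hasSum_single (j, ℓ) ?_ using 1
    · exact (hX_block j ℓ).symm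
    · rintro ⟨a, b⟩ hab
      dsimp only
      rw [← hX_block a b]
      by_cases ha : j = a
      · have hb : b ≠ ℓ := by
          rintro rfl
          exact hab (by rw [ha])
        rw [mul_assoc, mul_assoc _ (P b), hP_orth b ℓ hb, mul_zero, mul_zero]
      · rw [← mul_assoc, ← mul_assoc, hP_orth j a ha, zero_mul, zero_mul, zero_mul]
  refine ⟨Y, hY, ?_, fun Z hZ => eq_of_blocks_eq hP_sum fun j ℓ => (hZ j ℓ).trans (hY j ℓ).symm⟩
  refine le_of_tendsto hsum.norm (Filter.Eventually.of_forall fun s => ?_)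
  exact (norm_sum_blocks_le hP_sa hP_idem hP_sum hX_block s).trans
    (Real.sqrt_le_sqrt (hX_sq.sum_le_tsum s fun _ _ => sq_nonneg _))
end

section
/- Let (P_ℓ)_{ℓ∈ℤ} be a resolution of the identity on a complex Hilbert space H, and let X, Y be bounded operators on H with ‖X‖_{2,P} < ∞ and ‖Y‖_{2,P} < ∞. Then the product X ∘ Y satisfies ‖X ∘ Y‖_{2,P} ≤ ‖X‖_{2,P} · ‖Y‖_{2,P}; in particular X ∘ Y belongs to 𝔖₂(H,P). -/
/-- Cauchy–Schwarz for an operator product `X * Y` factored through a family of idempotents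
summing strongly to the identity. -/
theorem sq_norm_mul_le_tsum_mul_tsum
    {ι H : Type*} [NormedAddCommGroup H] [NormedSpace ℂ H] (P : ι → H →L[ℂ] H)
    (hP_idem : ∀ k, P k * P k = P k) (hP_sum : ∀ x : H, HasSum (fun k => P k x) x)
    (X Y : H →L[ℂ] H)
    (hX : Summable fun k => ‖X * P k‖ ^ 2) (hY : Summable fun k => ‖P k * Y‖ ^ 2) :
    ‖X * Y‖ ^ 2 ≤ (∑' k, ‖X * P k‖ ^ 2) * ∑' k, ‖P k * Y‖ ^ 2 := by
  set A := ∑' k, ‖X * P k‖ ^ 2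
  set B := ∑' k, ‖P k * Y‖ ^ 2
  have hA : 0 ≤ A := tsum_nonneg fun k => sq_nonneg _
  have hB : 0 ≤ B := tsum_nonneg fun k => sq_nonneg _
  have hbound : ‖X * Y‖ ≤ Real.sqrt (A * B) := by
    refine ContinuousLinearMap.opNorm_le_bound _ (Real.sqrt_nonneg _) fun x => ?_
    have hsum : HasSum (fun k => X (P k (Y x))) (X (Y x)) := (hP_sum (Y x)).mapL X
    refine le_of_tendsto hsum.norm (Filter.Eventually.of_forall fun s => ?_)
    have hterm : ∀ k ∈ s, ‖X (P k (Y x))‖ ≤ ‖X * P k‖ * ‖P k * Y‖ * ‖x‖ := fun k _ => by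
      have h : X (P k (Y x)) = ((X * P k) * (P k * Y)) x := by
        rw [mul_assoc, ← mul_assoc (P k), hP_idem]
        rfl
      rw [h]
      exact ContinuousLinearMap.le_of_opNorm_le _ (norm_mul_le _ _) x
    have hfin : ∑ k ∈ s, ‖X * P k‖ * ‖P k * Y‖ ≤ Real.sqrt (A * B) := by
      refine Real.le_sqrt_of_sq_le ((Finset.sum_mul_sq_le_sq_mul_sq _ _ _).trans ?_)
      exact mul_le_mul (hX.sum_le_tsum _ fun k _ => sq_nonneg _)
        (hY.sum_le_tsum _ fun k _ => sq_nonneg _) (Finset.sum_nonneg fun k _ => sq_nonneg _) hA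
    calc ‖∑ k ∈ s, X (P k (Y x))‖ ≤ ∑ k ∈ s, ‖X * P k‖ * ‖P k * Y‖ * ‖x‖ :=
          norm_sum_le_of_le _ hterm
      _ = (∑ k ∈ s, ‖X * P k‖ * ‖P k * Y‖) * ‖x‖ := (Finset.sum_mul _ _ _).symm
      _ ≤ Real.sqrt (A * B) * ‖x‖ := by gcongr
  exact (Real.le_sqrt (norm_nonneg _) (mul_nonneg hA hB)).mp hbound


/-- submultiplicativity of the block Hilbert–Schmidt norm ‖·‖_{2,P}. -/
theorem stmt_1
    {H : Type*} [NormedAddCommGroup H] [InnerProductSpace ℂ H] [CompleteSpace H]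
    (P : ℤ → H →L[ℂ] H)
    (hP_sa : ∀ ℓ, IsSelfAdjoint (P ℓ))
    (hP_idem : ∀ ℓ, P ℓ * P ℓ = P ℓ)
    (hP_orth : ∀ j ℓ, j ≠ ℓ → P j * P ℓ = 0)
    (hP_sum : ∀ x : H, HasSum (fun ℓ => P ℓ x) x)
    (X Y : H →L[ℂ] H)
    (hX : Summable (fun p : ℤ × ℤ => ‖P p.1 * X * P p.2‖ ^ 2))
    (hY : Summable (fun p : ℤ × ℤ => ‖P p.1 * Y * P p.2‖ ^ 2)) :
    Summable (fun p : ℤ × ℤ => ‖P p.1 * (X * Y) * P p.2‖ ^ 2) ∧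
    Real.sqrt (∑' p : ℤ × ℤ, ‖P p.1 * (X * Y) * P p.2‖ ^ 2) ≤
      Real.sqrt (∑' p : ℤ × ℤ, ‖P p.1 * X * P p.2‖ ^ 2) *
      Real.sqrt (∑' p : ℤ × ℤ, ‖P p.1 * Y * P p.2‖ ^ 2) := by
  have hY' : Summable (fun p : ℤ × ℤ => ‖P p.2 * Y * P p.1‖ ^ 2) := hY.prod_symm
  have hle : ∀ p : ℤ × ℤ, ‖P p.1 * (X * Y) * P p.2‖ ^ 2 ≤
      (∑' k, ‖P p.1 * X * P k‖ ^ 2) * ∑' k, ‖P k * Y * P p.2‖ ^ 2 := fun p => by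
    have h := sq_norm_mul_le_tsum_mul_tsum P hP_idem hP_sum (P p.1 * X) (Y * P p.2)
      (hX.prod_factor p.1) (by simpa only [mul_assoc] using hY'.prod_factor p.2)
    simpa only [mul_assoc] using h
  have hprod := hX.prod.mul_of_nonneg hY'.prod
    (fun j => tsum_nonneg fun k => sq_nonneg _) (fun l => tsum_nonneg fun k => sq_nonneg _)
  have hXY : Summable (fun p : ℤ × ℤ => ‖P p.1 * (X * Y) * P p.2‖ ^ 2) :=
    hprod.of_nonneg_of_le (fun p => sq_nonneg _) hle
  refine ⟨hXY, ?_⟩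
  rw [← Real.sqrt_mul (tsum_nonneg fun p => sq_nonneg _)]
  refine Real.sqrt_le_sqrt ((hXY.tsum_le_tsum hle hprod).trans_eq ?_)
  rw [← hX.prod.tsum_mul_tsum hY'.prod hprod, ← hX.tsum_prod, ← hY'.tsum_prod]
  congr 1
  exact (Equiv.prodComm ℤ ℤ).tsum_eq (fun p : ℤ × ℤ => ‖P p.1 * Y * P p.2‖ ^ 2)
end

section
/- Let H be a complex Hilbert space and let A : ℤ → B(H) satisfy ∑_{n∈ℤ} ‖A(n)‖ < ∞. Then for every j, ℓ ∈ ℤ the family (n ↦ (ℓ − n)^{-1} · A(j+n) ∘ A(ℓ+n)), indexed by n ∈ ℤ with n ≠ ℓ, is absolutely summable in B(H), and, denoting its sum by S(j,ℓ), the family ((j,ℓ) ↦ ‖S(j,ℓ)‖²) is summable over ℤ × ℤ, i.e. ∑_{j,ℓ∈ℤ} ‖∑_{n≠ℓ} A(j+n) ∘ A(ℓ+n)/(ℓ−n)‖² < ∞. -/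
/-- Weighted Cauchy–Schwarz inequality for series, including convergence of the left side. -/
theorem summable_mul_and_sq_tsum_le {ι : Type*} {b w : ι → ℝ}
    (hb : ∀ i, 0 ≤ b i) (hw : ∀ i, 0 ≤ w i)
    (hsb : Summable b) (hsw : Summable fun i => b i * w i ^ 2) :
    Summable (fun i => b i * w i) ∧
      (∑' i, b i * w i) ^ 2 ≤ (∑' i, b i) * ∑' i, b i * w i ^ 2 := by
  have hs : Summable (fun i => b i * w i) := by
    refine Summable.of_nonneg_of_le (fun i => mul_nonneg (hb i) (hw i)) (fun i => ?_)
      (hsb.add hsw)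
    have h : w i ≤ 1 + w i ^ 2 := by nlinarith [sq_nonneg (w i - 1), hw i]
    calc b i * w i ≤ b i * (1 + w i ^ 2) := mul_le_mul_of_nonneg_left h (hb i)
      _ = b i + b i * w i ^ 2 := by ring
  refine ⟨hs, le_of_tendsto' (hs.hasSum.pow 2) fun s => ?_⟩
  have hbw : ∀ i, 0 ≤ b i * w i ^ 2 := fun i => mul_nonneg (hb i) (sq_nonneg _)
  calc (∑ i ∈ s, b i * w i) ^ 2
      ≤ (∑ i ∈ s, b i) * ∑ i ∈ s, b i * w i ^ 2 :=
        Finset.sum_sq_le_sum_mul_sum_of_sq_le_mul s (fun i _ => hb i) (fun i _ => hbw i)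
          (fun i _ => (by ring : (b i * w i) ^ 2 = b i * (b i * w i ^ 2)).le)
    _ ≤ (∑' i, b i) * ∑' i, b i * w i ^ 2 :=
        mul_le_mul (hsb.sum_le_tsum s fun i _ => hb i) (hsw.sum_le_tsum s fun i _ => hbw i)
          (Finset.sum_nonneg fun i _ => hbw i) (tsum_nonneg hb)

theorem summable_shift_mul_shift_mul {a v : ℤ → ℝ} (ha : ∀ n, 0 ≤ a n) (hv : ∀ n, 0 ≤ v n)
    (hsa : Summable a) (hsv : Summable v) :
    Summable fun q : (ℤ × ℤ) × ℤ => a (q.1.1 + q.2) * a (q.1.2 + q.2) * v (q.1.2 - q.2) := by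
  have hpair : Summable fun p : ℤ × ℤ => a p.1 * a p.2 := hsa.mul_of_nonneg hsa ha ha
  have h : Summable fun q : (ℤ × ℤ) × ℤ => a q.1.1 * a q.1.2 * v q.2 :=
    hpair.mul_of_nonneg hsv (fun p => mul_nonneg (ha p.1) (ha p.2)) hv
  have hinj : Function.Injective
      fun q : (ℤ × ℤ) × ℤ => ((q.1.1 + q.2, q.1.2 + q.2), q.1.2 - q.2) := by
    rintro ⟨⟨j, l⟩, n⟩ ⟨⟨j', l'⟩, n'⟩ heq
    simp only [Prod.mk.injEq] at heq
    obtain ⟨⟨hj, hl⟩, hd⟩ := heq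
    obtain rfl : n = n' := by omega
    obtain rfl : l = l' := by omega
    obtain rfl : j = j' := by omega
    rfl
  simpa only [Function.comp_def] using h.comp_injective hinj

theorem summable_shift_mul_shift_and_tsum_le {a : ℤ → ℝ} (ha : ∀ n, 0 ≤ a n)
    (hsa : Summable a) (j l : ℤ) :
    Summable (fun n => a (j + n) * a (l + n)) ∧
      ∑' n, a (j + n) * a (l + n) ≤ (∑' n, a n) ^ 2 := by
  have hle : ∀ n, a (j + n) * a (l + n) ≤ a (j + n) * ∑' m, a m := fun n =>
    mul_le_mul_of_nonneg_left (hsa.le_tsum _ fun m _ => ha m) (ha _)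
  have hj : Summable fun n => a (j + n) := hsa.comp_injective (add_right_injective j)
  have hs := Summable.of_nonneg_of_le (fun n => mul_nonneg (ha _) (ha _)) hle (hj.mul_right _)
  refine ⟨hs, (hs.tsum_le_tsum hle (hj.mul_right _)).trans_eq ?_⟩
  have ht : ∑' n, a (j + n) = ∑' n, a n := (Equiv.addLeft j).tsum_eq a
  rw [tsum_mul_right, ht, sq]

/-- if the operator coefficients A(n) are absolutely summable in norm, then
the sums S(j,ℓ) = ∑_{n≠ℓ} A(j+n)A(ℓ+n)/(ℓ−n) exist (absolutely) and are square-summable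
over (j,ℓ) ∈ ℤ². -/
theorem stmt_4
    {H : Type*} [NormedAddCommGroup H] [InnerProductSpace ℂ H] [CompleteSpace H]
    (A : ℤ → H →L[ℂ] H)
    (hA : Summable (fun n : ℤ => ‖A n‖)) :
    (∀ j ℓ : ℤ, Summable (fun n : {n : ℤ // n ≠ ℓ} =>
      ‖(((ℓ - (n : ℤ) : ℤ) : ℝ))⁻¹ • (A (j + (n : ℤ)) * A (ℓ + (n : ℤ)))‖)) ∧
    Summable (fun p : ℤ × ℤ =>
      ‖∑' n : {n : ℤ // n ≠ p.2},
        (((p.2 - (n : ℤ) : ℤ) : ℝ))⁻¹ • (A (p.1 + (n : ℤ)) * A (p.2 + (n : ℤ)))‖ ^ 2) := by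
  have ha : ∀ n, 0 ≤ ‖A n‖ := fun n => norm_nonneg _
  have hv : Summable fun k : ℤ => |(k : ℝ)⁻¹| ^ 2 := by
    have h : Summable fun k : ℤ => 1 / (k : ℝ) ^ 2 :=
      Real.summable_one_div_int_pow.mpr one_lt_two
    simpa [sq_abs] using h
  have htriple := summable_shift_mul_shift_mul ha (fun k => sq_nonneg |(k : ℝ)⁻¹|) hA hv
  have hbase := fun j l => summable_shift_mul_shift_and_tsum_le ha hA j l
  have hcs := fun j l : ℤ => summable_mul_and_sq_tsum_le
    (b := fun n => ‖A (j + n)‖ * ‖A (l + n)‖) (w := fun n => |((l - n : ℤ) : ℝ)⁻¹|)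
    (fun n => mul_nonneg (ha _) (ha _)) (fun n => abs_nonneg _) (hbase j l).1
    (htriple.prod_factor (j, l))
  have hterm : ∀ j l n : ℤ, ‖(((l - n : ℤ) : ℝ))⁻¹ • (A (j + n) * A (l + n))‖ ≤
      ‖A (j + n)‖ * ‖A (l + n)‖ * |((l - n : ℤ) : ℝ)⁻¹| := fun j l n => by
    rw [norm_smul, Real.norm_eq_abs, mul_comm]
    exact mul_le_mul_of_nonneg_right (norm_mul_le _ _) (abs_nonneg _)
  have hnorm : ∀ j l : ℤ, Summable fun n : ℤ =>
      ‖(((l - n : ℤ) : ℝ))⁻¹ • (A (j + n) * A (l + n))‖ := fun j l =>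
    Summable.of_nonneg_of_le (fun n => norm_nonneg _) (hterm j l) (hcs j l).1
  have hsub : ∀ j l : ℤ, Summable (fun n : {n : ℤ // n ≠ l} =>
      ‖(((l - (n : ℤ) : ℤ) : ℝ))⁻¹ • (A (j + (n : ℤ)) * A (l + (n : ℤ)))‖) := fun j l =>
    (hnorm j l).comp_injective Subtype.val_injective
  refine ⟨hsub, Summable.of_nonneg_of_le (fun p => sq_nonneg _) (fun p => ?_)
    (htriple.prod.mul_left ((∑' n, ‖A n‖) ^ 2))⟩
  obtain ⟨j, l⟩ := p
  have hS : ‖∑' n : {n : ℤ // n ≠ l},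
      (((l - (n : ℤ) : ℤ) : ℝ))⁻¹ • (A (j + (n : ℤ)) * A (l + (n : ℤ)))‖ ≤
      ∑' n : ℤ, ‖A (j + n)‖ * ‖A (l + n)‖ * |((l - n : ℤ) : ℝ)⁻¹| :=
    (norm_tsum_le_tsum_norm (hsub j l)).trans <|
      ((hnorm j l).tsum_subtype_le _ {n | n ≠ l} fun n => norm_nonneg _).trans <|
        (hnorm j l).tsum_le_tsum (hterm j l) (hcs j l).1
  exact (pow_le_pow_left₀ (norm_nonneg _) hS 2).trans <| (hcs j l).2.trans <|
    mul_le_mul_of_nonneg_right (hbase j l).2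
      (tsum_nonneg fun n => mul_nonneg (mul_nonneg (ha _) (ha _)) (sq_nonneg _))
end

section
/- Let E be a normed additive group and let A : ℤ → E satisfy ∑_{n∈ℤ} ‖A(n)‖² < ∞. Then the family ((j,ℓ) ↦ ‖A(j+ℓ)‖² / (j−ℓ)²), indexed by pairs (j,ℓ) ∈ ℤ × ℤ with j ≠ ℓ, is summable, i.e. ∑_{(j,ℓ)∈ℤ², j≠ℓ} ‖A(j+ℓ)‖²/(j−ℓ)² < ∞. -/
/-- if ∑ ‖A(n)‖² < ∞ then the family ‖A(j+ℓ)‖²/(j−ℓ)², indexed by pairs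
(j,ℓ) with j ≠ ℓ, is summable. -/
theorem stmt_5
    {E : Type*} [NormedAddGroup E]
    (A : ℤ → E)
    (hA : Summable (fun n : ℤ => ‖A n‖ ^ 2)) :
    Summable (fun p : {p : ℤ × ℤ // p.1 ≠ p.2} =>
      ‖A (p.1.1 + p.1.2)‖ ^ 2 / ((p.1.1 - p.1.2 : ℤ) : ℝ) ^ 2) := by
  have hsq : Summable (fun n : ℤ => 1 / (n : ℝ) ^ 2) :=
    Real.summable_one_div_int_pow.mpr one_lt_two
  have hprod := hA.mul_of_nonneg hsq (fun _ => by positivity) (fun _ => by positivity)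
  have hinj : Function.Injective
      (fun p : {p : ℤ × ℤ // p.1 ≠ p.2} => (p.1.1 + p.1.2, p.1.1 - p.1.2)) := by
    rintro ⟨⟨a, b⟩, _⟩ ⟨⟨c, d⟩, _⟩ h
    simp only [Prod.mk.injEq, Subtype.mk.injEq] at h ⊢
    omega
  refine (hprod.comp_injective hinj).congr fun p => ?_
  simp only [Function.comp_apply, mul_one_div]
end

section
/- Let E be a normed additive group and let A : ℤ → E satisfy ∑_{n∈ℤ} ‖A(n)‖² < ∞. Then for every ε > 0 there exists N ∈ ℕ, N ≥ 1, such that ∑_{j,ℓ∈ℤ} ‖A(j+ℓ)‖²/(j² + N²) < ε². -/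
open Filter in
/-- The comparison series for `∑ j, 1 / (j² + N²)`, `N ≥ 1`, is summable. -/
lemma summable_one_div_int_sq_add_one :
    Summable (fun j : ℤ => 1 / ((j : ℝ) ^ 2 + 1)) := by
  refine Summable.of_norm_bounded_eventually
    (Real.summable_one_div_int_pow.mpr one_lt_two) ?_
  have h : ∀ᶠ j : ℤ in cofinite, j ≠ 0 := (Set.finite_singleton (0 : ℤ)).compl_mem_cofinite
  filter_upwards [h] with j hj
  have hj' : (0 : ℝ) < (j : ℝ) ^ 2 := by positivity
  rw [Real.norm_of_nonneg (by positivity)]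
  gcongr
  linarith

lemma norm_one_div_int_sq_add_sq_le {N : ℕ} (hN : 1 ≤ N) (j : ℤ) :
    ‖1 / ((j : ℝ) ^ 2 + (N : ℝ) ^ 2)‖ ≤ 1 / ((j : ℝ) ^ 2 + 1) := by
  have hN' : (1 : ℝ) ≤ N := by exact_mod_cast hN
  rw [Real.norm_of_nonneg (by positivity)]
  gcongr
  nlinarith

lemma summable_one_div_int_sq_add_sq {N : ℕ} (hN : 1 ≤ N) :
    Summable (fun j : ℤ => 1 / ((j : ℝ) ^ 2 + (N : ℝ) ^ 2)) :=
  .of_norm_bounded summable_one_div_int_sq_add_one (norm_one_div_int_sq_add_sq_le hN)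

open Filter Topology in
lemma tendsto_tsum_one_div_int_sq_add_sq :
    Tendsto (fun N : ℕ => ∑' j : ℤ, 1 / ((j : ℝ) ^ 2 + (N : ℝ) ^ 2)) atTop (𝓝 0) := by
  have h := tendsto_tsum_of_dominated_convergence
    (f := fun (N : ℕ) (j : ℤ) => 1 / ((j : ℝ) ^ 2 + (N : ℝ) ^ 2)) (g := fun _ => 0)
    (𝓕 := atTop) summable_one_div_int_sq_add_one
    (fun j => tendsto_const_nhds.div_atTop <| tendsto_atTop_add_const_left _ _ <|
      (tendsto_pow_atTop two_ne_zero).comp tendsto_natCast_atTop_atTop)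
    (by filter_upwards [eventually_ge_atTop 1] with N hN
        exact norm_one_div_int_sq_add_sq_le hN)
  simpa using h

/-- The sum over `ℤ × ℤ` of `g j * a (j + l)` factors for nonnegative summable `g` and `a`. -/
lemma hasSum_mul_comp_add {G : Type*} [AddGroup G] {g a : G → ℝ}
    (hg : Summable g) (ha : Summable a) (hg₀ : 0 ≤ g) (ha₀ : 0 ≤ a) :
    HasSum (fun p : G × G => g p.1 * a (p.1 + p.2)) ((∑' j, g j) * ∑' n, a n) := by
  have h := hg.hasSum.mul ha.hasSum (hg.mul_of_nonneg ha hg₀ ha₀)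
  exact ((Equiv.refl G).prodShear Equiv.addLeft).hasSum_iff.mpr h

/-- if ∑ ‖A(n)‖² < ∞ then for every ε > 0 there is N ≥ 1 such that
∑_{j,ℓ} ‖A(j+ℓ)‖²/(j² + N²) < ε². -/
theorem stmt_6
    {E : Type*} [NormedAddGroup E]
    (A : ℤ → E)
    (hA : Summable (fun n : ℤ => ‖A n‖ ^ 2)) :
    ∀ ε > (0 : ℝ), ∃ N : ℕ, 1 ≤ N ∧
      Summable (fun p : ℤ × ℤ =>
        ‖A (p.1 + p.2)‖ ^ 2 / (((p.1 : ℝ)) ^ 2 + (N : ℝ) ^ 2)) ∧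
      (∑' p : ℤ × ℤ, ‖A (p.1 + p.2)‖ ^ 2 / (((p.1 : ℝ)) ^ 2 + (N : ℝ) ^ 2)) < ε ^ 2 := by
  intro ε hε
  have hlim := tendsto_tsum_one_div_int_sq_add_sq.mul_const (∑' n, ‖A n‖ ^ 2)
  rw [zero_mul] at hlim
  obtain ⟨N, hN, hlt⟩ :=
    ((Filter.eventually_ge_atTop 1).and (hlim.eventually_lt_const (pow_pos hε 2))).exists
  have hsum := hasSum_mul_comp_add (summable_one_div_int_sq_add_sq hN) hA
    (fun j => by positivity) (fun n => by positivity)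
  simp only [one_div_mul_eq_div] at hsum
  exact ⟨N, hN, hsum.summable, hsum.tsum_eq.trans_lt hlt⟩
end

section
/- Let (P_ℓ)_{ℓ∈ℤ} be a resolution of the identity on a complex Hilbert space H, let ω > 0, k ∈ ℕ, and let X be a bounded operator on H with ‖X‖_{2,P} < ∞. Let α : ℤ → [0,∞) and let a, α' ≥ 0 be constants such that α_ℓ ≤ a whenever |ℓ| ≥ k+1, and |α_i − α_j| ≤ α' · |i − j| whenever |i| ≥ k+1 and |j| ≤ k. Then ( ∑_{(j,ℓ): j≠ℓ and max(|j|,|ℓ|)>k} (ω/(2π))² · α_ℓ² · ‖P_j X P_ℓ‖²/(j−ℓ)² )^{1/2} ≤ (ω/(2π)) · (2a + α') · ‖X‖_{2,P}. -/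
/-- The weight `α ℓ` grows at most linearly in the distance of `ℓ` to any `j ≠ ℓ`, as soon as one of
the two indices lies outside `[-k, k]`. -/
theorem weight_le_mul_abs_sub {k : ℕ} {α : ℤ → ℝ} {a α' : ℝ} (ha : 0 ≤ a) (hα' : 0 ≤ α')
    (hbound : ∀ ℓ : ℤ, (k : ℤ) + 1 ≤ |ℓ| → α ℓ ≤ a)
    (hlip : ∀ i j : ℤ, (k : ℤ) + 1 ≤ |i| → |j| ≤ (k : ℤ) →
      |α i - α j| ≤ α' * |(i - j : ℤ)|)
    {j ℓ : ℤ} (hne : j ≠ ℓ) (hmax : (k : ℤ) < max |j| |ℓ|) :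
    α ℓ ≤ (a + α') * |((j - ℓ : ℤ) : ℝ)| := by
  have one_le : (1 : ℝ) ≤ |((j - ℓ : ℤ) : ℝ)| := by
    exact_mod_cast Int.one_le_abs (sub_ne_zero.mpr hne)
  rcases le_or_gt |ℓ| (k : ℤ) with hℓ | hℓ
  · have hj : (k : ℤ) + 1 ≤ |j| := (lt_max_iff.mp hmax).resolve_right hℓ.not_gt
    have h := (abs_le.mp (hlip j ℓ hj hℓ)).1
    push_cast at h one_le ⊢
    nlinarith [hbound j hj]
  · nlinarith [hbound ℓ hℓ]


/-- Lemma 5.1: weighted estimate ‖Γ_k(XF)‖_{2,P} ≤ (ω/2π)(2a+α')‖X‖_{2,P}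
for a weight sequence α with α_ℓ ≤ a for |ℓ| ≥ k+1 and |α_i − α_j| ≤ α'|i−j| for
|i| ≥ k+1, |j| ≤ k. -/
theorem stmt_8
    {H : Type*} [NormedAddCommGroup H] [InnerProductSpace ℂ H] [CompleteSpace H]
    (P : ℤ → H →L[ℂ] H)
    (hP_sa : ∀ ℓ, IsSelfAdjoint (P ℓ))
    (hP_idem : ∀ ℓ, P ℓ * P ℓ = P ℓ)
    (hP_orth : ∀ j ℓ, j ≠ ℓ → P j * P ℓ = 0)
    (hP_sum : ∀ x : H, HasSum (fun ℓ => P ℓ x) x)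
    (ω : ℝ) (hω : 0 < ω) (k : ℕ)
    (X : H →L[ℂ] H)
    (hX : Summable (fun p : ℤ × ℤ => ‖P p.1 * X * P p.2‖ ^ 2))
    (α : ℤ → ℝ) (hα_nonneg : ∀ ℓ, 0 ≤ α ℓ)
    (a α' : ℝ) (ha : 0 ≤ a) (hα' : 0 ≤ α')
    (hbound : ∀ ℓ : ℤ, (k : ℤ) + 1 ≤ |ℓ| → α ℓ ≤ a)
    (hlip : ∀ i j : ℤ, (k : ℤ) + 1 ≤ |i| → |j| ≤ (k : ℤ) →
      |α i - α j| ≤ α' * |(i - j : ℤ)|) :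
    Real.sqrt (∑' p : {q : ℤ × ℤ // q.1 ≠ q.2 ∧ (k : ℤ) < max |q.1| |q.2|},
        (ω / (2 * Real.pi)) ^ 2 * (α p.1.2) ^ 2 * ‖P p.1.1 * X * P p.1.2‖ ^ 2
          / ((p.1.1 - p.1.2 : ℤ) : ℝ) ^ 2) ≤
      (ω / (2 * Real.pi)) * (2 * a + α') *
        Real.sqrt (∑' p : ℤ × ℤ, ‖P p.1 * X * P p.2‖ ^ 2) := by
  set c := ω / (2 * Real.pi)
  have hc : 0 ≤ c := by positivity
  set f : ℤ × ℤ → ℝ := fun p => ‖P p.1 * X * P p.2‖ ^ 2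
  have hf : ∀ p, 0 ≤ f p := fun p => by positivity
  set C := c * (2 * a + α')
  have hC : 0 ≤ C := by positivity
  set S := {q : ℤ × ℤ | q.1 ≠ q.2 ∧ (k : ℤ) < max |q.1| |q.2|}
  have term_le : ∀ p : S, c ^ 2 * (α p.1.2) ^ 2 * f p / ((p.1.1 - p.1.2 : ℤ) : ℝ) ^ 2 ≤
      C ^ 2 * f p := by
    rintro ⟨⟨j, ℓ⟩, hne, hmax⟩
    have hpos : 0 < ((j - ℓ : ℤ) : ℝ) ^ 2 := by
      have : ((j - ℓ : ℤ) : ℝ) ≠ 0 := by exact_mod_cast sub_ne_zero.mpr hne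
      positivity
    have hα : α ℓ ≤ (2 * a + α') * |((j - ℓ : ℤ) : ℝ)| :=
      (weight_le_mul_abs_sub ha hα' hbound hlip hne hmax).trans (by gcongr; linarith)
    have hsq : α ℓ ^ 2 ≤ (2 * a + α') ^ 2 * ((j - ℓ : ℤ) : ℝ) ^ 2 := by
      rw [← sq_abs ((j - ℓ : ℤ) : ℝ), ← mul_pow]
      exact pow_le_pow_left₀ (hα_nonneg ℓ) hα 2
    rw [div_le_iff₀ hpos]
    calc c ^ 2 * α ℓ ^ 2 * f (j, ℓ)
        ≤ c ^ 2 * ((2 * a + α') ^ 2 * ((j - ℓ : ℤ) : ℝ) ^ 2) * f (j, ℓ) := by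
          gcongr
      _ = C ^ 2 * f (j, ℓ) * ((j - ℓ : ℤ) : ℝ) ^ 2 := by simp only [C]; ring
  have dominating : Summable fun p : S => C ^ 2 * f p := (hX.subtype S).mul_left _
  have sum_le : ∑' p : S, c ^ 2 * (α p.1.2) ^ 2 * f p / ((p.1.1 - p.1.2 : ℤ) : ℝ) ^ 2 ≤
      C ^ 2 * ∑' p, f p :=
    calc _ ≤ ∑' p : S, C ^ 2 * f p :=
          (dominating.of_nonneg_of_le
            (fun p : S => div_nonneg (mul_nonneg (by positivity) (hf p)) (sq_nonneg _))
            term_le).tsum_le_tsum term_le dominating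
      _ = C ^ 2 * ∑' p : S, f p := tsum_mul_left
      _ ≤ C ^ 2 * ∑' p, f p := by
          gcongr
          exact hX.tsum_subtype_le f S hf
  calc _ ≤ Real.sqrt (C ^ 2 * ∑' p, f p) := Real.sqrt_le_sqrt sum_le
    _ = C * Real.sqrt (∑' p, f p) := by rw [Real.sqrt_mul (sq_nonneg C), Real.sqrt_sq hC]
end

section
/- Let H be a complex Hilbert space, D ⊆ H a linear subspace, and A, B, C : D → H linear maps. Let G be a bounded linear operator on H with operator norm ‖G‖ < 1 and with G(D) ⊆ D, and assume the commutation relation A(Gx) − G(Ax) = Bx − Cx for all x ∈ D. Then I + G is invertible in B(H), and for every x ∈ D one has A(x + Gx) − B(x + Gx) = (I + G)( Ax − Cx − B₀x ), where B₀x := (I + G)^{-1}( B(Gx) − G(Cx) ). -/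
/-- the first similarity transform, Theorem 4.2: if ‖G‖ < 1, G preserves
the subspace D, and A(Gx) − G(Ax) = Bx − Cx on D, then I + G is invertible and
(A − B)(I + G)x = (I + G)(A − C − B₀)x on D, with B₀x = (I+G)⁻¹(B(Gx) − G(Cx)). -/
theorem stmt_11
    {H : Type*} [NormedAddCommGroup H] [InnerProductSpace ℂ H] [CompleteSpace H]
    (D : Submodule ℂ H)
    (A B C : D →ₗ[ℂ] H)
    (G : H →L[ℂ] H) (hG : ‖G‖ < 1)
    (hGD : ∀ x ∈ D, G x ∈ D)
    (hcomm : ∀ x : D, A ⟨G (x : H), hGD (x : H) x.2⟩ - G (A x) = B x - C x) :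
    ∃ U : H →L[ℂ] H,
      (1 + G) * U = 1 ∧ U * (1 + G) = 1 ∧
      ∀ x : D,
        A ⟨(x : H) + G (x : H), D.add_mem x.2 (hGD (x : H) x.2)⟩ -
          B ⟨(x : H) + G (x : H), D.add_mem x.2 (hGD (x : H) x.2)⟩ =
        (1 + G) ((A x - C x) - U (B ⟨G (x : H), hGD (x : H) x.2⟩ - G (C x))) := by
  have hunit : IsUnit (1 + G) := by
    simpa using isUnit_one_sub_of_norm_lt_one (x := -G) (by simpa using hG)
  obtain ⟨u, hu⟩ := hunit
  have hright : (1 + G) * (↑u⁻¹ : H →L[ℂ] H) = 1 := by rw [← hu, u.mul_inv]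
  have hleft : (↑u⁻¹ : H →L[ℂ] H) * (1 + G) = 1 := by rw [← hu, u.inv_mul]
  refine ⟨↑u⁻¹, hright, hleft, fun x => ?_⟩
  have hcancel : ∀ y : H, (1 + G) ((↑u⁻¹ : H →L[ℂ] H) y) = y := fun y =>
    DFunLike.congr_fun hright y
  have hsplit : (⟨(x : H) + G (x : H), D.add_mem x.2 (hGD (x : H) x.2)⟩ : D) =
      x + ⟨G (x : H), hGD (x : H) x.2⟩ := rfl
  rw [hsplit, map_add, map_add, map_sub, hcancel, sub_eq_iff_eq_add.mp (hcomm x)]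
  simp only [add_apply, one_apply_eq_self, map_sub]
  abel
end

section
/- Let ℳ be a complex Banach space, B ∈ ℳ, and let J : ℳ → ℳ be a bounded linear idempotent (J ∘ J = J) with 1 ≤ ‖J‖. Let γ > 0 and let p, q : ℳ × ℳ → ℳ be bilinear maps satisfying ‖p(X,Y)‖ ≤ γ‖X‖‖Y‖ and ‖q(X,Y)‖ ≤ γ‖X‖‖Y‖ for all X, Y ∈ ℳ. Assume 4γ‖J‖‖B‖ < 1, and define Φ : ℳ → ℳ by Φ(X) = p(B,X) − q(X, J(B)) − q(X, J(p(B,X))) + B. Then Φ maps the closed ball 𝔅 = {X ∈ ℳ : ‖X − B‖ ≤ 3‖B‖} into itself, Φ is Lipschitz on 𝔅 with a Lipschitz constant strictly less than 1, and Φ has a unique fixed point X* in 𝔅, which is the limit of the iterates X₀ = 0, X_{n+1} = Φ(X_n). -/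
/-- A bilinear map bounded by `γ` is bounded on arguments of bounded norm. -/
theorem norm_bilin_le_of_le {M : Type*} [NormedAddCommGroup M] [NormedSpace ℂ M]
    {γ : ℝ} (hγ : 0 ≤ γ) {p : M →ₗ[ℂ] M →ₗ[ℂ] M}
    (hp : ∀ X Y : M, ‖p X Y‖ ≤ γ * ‖X‖ * ‖Y‖) {X Y : M} {a b : ℝ}
    (hX : ‖X‖ ≤ a) (hY : ‖Y‖ ≤ b) : ‖p X Y‖ ≤ γ * a * b := by
  have ha : 0 ≤ a := (norm_nonneg X).trans hX
  exact (hp X Y).trans (by gcongr)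

/-- The Banach fixed point theorem for a map that contracts a closed ball into itself. -/
theorem exists_unique_fixedPoint_of_contracting_ball {M : Type*} [NormedAddCommGroup M]
    [CompleteSpace M] {Φ : M → M} {B x₀ : M} {r K : ℝ}
    (hmaps : ∀ X : M, ‖X - B‖ ≤ r → ‖Φ X - B‖ ≤ r) (hK0 : 0 ≤ K) (hK1 : K < 1)
    (hlip : ∀ X Y : M, ‖X - B‖ ≤ r → ‖Y - B‖ ≤ r → ‖Φ X - Φ Y‖ ≤ K * ‖X - Y‖)
    (hx₀ : ‖x₀ - B‖ ≤ r) :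
    ∃ Xs : M, ‖Xs - B‖ ≤ r ∧ Φ Xs = Xs ∧
      (∀ Y : M, ‖Y - B‖ ≤ r → Φ Y = Y → Y = Xs) ∧
      Filter.Tendsto (fun n : ℕ => Φ^[n] x₀) Filter.atTop (nhds Xs) := by
  have hmem (X : M) : X ∈ Metric.closedBall B r ↔ ‖X - B‖ ≤ r := mem_closedBall_iff_norm
  have hmt : Set.MapsTo Φ (Metric.closedBall B r) (Metric.closedBall B r) :=
    fun X hX => (hmem _).2 (hmaps X ((hmem X).1 hX))
  have hc : ContractingWith ⟨K, hK0⟩ (hmt.restrict Φ _ _) := by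
    refine ⟨by exact_mod_cast hK1, LipschitzWith.of_dist_le_mul fun X Y => ?_⟩
    rw [Subtype.dist_eq, Subtype.dist_eq, dist_eq_norm, dist_eq_norm]
    exact hlip X Y ((hmem _).1 X.2) ((hmem _).1 Y.2)
  obtain ⟨Xs, hXs, hfix, htend, -⟩ :=
    hc.exists_fixedPoint' Metric.isClosed_closedBall.isComplete hmt ((hmem x₀).2 hx₀)
      (edist_ne_top _ _)
  have hXs' := (hmem _).1 hXs
  refine ⟨Xs, hXs', hfix, fun Y hY hYfix => ?_, htend⟩
  have h := hlip Y Xs hY hXs'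
  rw [hYfix, hfix.eq] at h
  have h0 : ‖Y - Xs‖ = 0 := by nlinarith [norm_nonneg (Y - Xs)]
  exact sub_eq_zero.1 (norm_eq_zero.1 h0)

/-- contraction/fixed-point core of Theorem 3.6: under 4γ‖J‖‖B‖ < 1 the
map Φ(X) = p(B,X) − q(X,J(B)) − q(X,J(p(B,X))) + B maps the ball {‖X−B‖ ≤ 3‖B‖} into
itself, is a contraction there, and has a unique fixed point X* which is the limit of
the iterates starting from 0. -/
theorem stmt_12
    {M : Type*} [NormedAddCommGroup M] [NormedSpace ℂ M] [CompleteSpace M]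
    (B : M) (J : M →L[ℂ] M) (hJ_idem : J.comp J = J) (hJ_norm : 1 ≤ ‖J‖)
    (γ : ℝ) (hγ : 0 < γ)
    (p q : M →ₗ[ℂ] M →ₗ[ℂ] M)
    (hp : ∀ X Y : M, ‖p X Y‖ ≤ γ * ‖X‖ * ‖Y‖)
    (hq : ∀ X Y : M, ‖q X Y‖ ≤ γ * ‖X‖ * ‖Y‖)
    (hsmall : 4 * γ * ‖J‖ * ‖B‖ < 1)
    (Φ : M → M)
    (hΦ : ∀ X : M, Φ X = p B X - q X (J B) - q X (J (p B X)) + B) :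
    (∀ X : M, ‖X - B‖ ≤ 3 * ‖B‖ → ‖Φ X - B‖ ≤ 3 * ‖B‖) ∧
    (∃ K : ℝ, 0 ≤ K ∧ K < 1 ∧
      ∀ X Y : M, ‖X - B‖ ≤ 3 * ‖B‖ → ‖Y - B‖ ≤ 3 * ‖B‖ →
        ‖Φ X - Φ Y‖ ≤ K * ‖X - Y‖) ∧
    ∃ Xs : M, ‖Xs - B‖ ≤ 3 * ‖B‖ ∧ Φ Xs = Xs ∧
      (∀ Y : M, ‖Y - B‖ ≤ 3 * ‖B‖ → Φ Y = Y → Y = Xs) ∧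
      Filter.Tendsto (fun n : ℕ => Φ^[n] 0) Filter.atTop (nhds Xs) := by
  have hb : 0 ≤ ‖B‖ := norm_nonneg B
  have hj : 0 ≤ ‖J‖ := norm_nonneg J
  set s : ℝ := γ * ‖J‖ * ‖B‖ with hs
  have hs0 : 0 ≤ s := by positivity
  have hs1 : 4 * s < 1 := by linarith
  have hts : γ * ‖B‖ ≤ s := by
    nlinarith [mul_nonneg (mul_nonneg hγ.le hb) (sub_nonneg.2 hJ_norm)]
  have hball (X : M) (hX : ‖X - B‖ ≤ 3 * ‖B‖) : ‖X‖ ≤ 4 * ‖B‖ := by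
    linarith [norm_le_norm_add_norm_sub' X B]
  have hqJ (X Y : M) {a c : ℝ} (hX : ‖X‖ ≤ a) (hY : ‖Y‖ ≤ c) :
      ‖q X (J Y)‖ ≤ γ * a * (‖J‖ * c) :=
    norm_bilin_le_of_le hγ.le hq hX (J.le_opNorm_of_le hY)
  have hpB (X : M) {a : ℝ} (hX : ‖X‖ ≤ a) : ‖p B X‖ ≤ s * a := by
    have ha : 0 ≤ a := (norm_nonneg X).trans hX
    exact (norm_bilin_le_of_le hγ.le hp le_rfl hX).trans (by gcongr)
  have hmaps (X : M) (hX : ‖X - B‖ ≤ 3 * ‖B‖) : ‖Φ X - B‖ ≤ 3 * ‖B‖ := by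
    have hX4 := hball X hX
    have h1 := hpB X hX4
    have h2 := hqJ X B hX4 le_rfl
    have h3 := hqJ X (p B X) hX4 h1
    have hΦX : Φ X - B = p B X - q X (J B) - q X (J (p B X)) := by
      rw [hΦ]; abel
    calc ‖Φ X - B‖ ≤ ‖p B X‖ + ‖q X (J B)‖ + ‖q X (J (p B X))‖ := by
          rw [hΦX]
          exact (norm_sub_le _ _).trans (by gcongr; exact norm_sub_le _ _)
      _ ≤ s * (4 * ‖B‖) + γ * (4 * ‖B‖) * (‖J‖ * ‖B‖)
            + γ * (4 * ‖B‖) * (‖J‖ * (s * (4 * ‖B‖))) := by gcongr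
      _ = (8 * s + 16 * s ^ 2) * ‖B‖ := by rw [hs]; ring
      _ ≤ 3 * ‖B‖ := by gcongr; nlinarith
  have hlip (X Y : M) (hX : ‖X - B‖ ≤ 3 * ‖B‖) (hY : ‖Y - B‖ ≤ 3 * ‖B‖) :
      ‖Φ X - Φ Y‖ ≤ (2 * s + 8 * s ^ 2) * ‖X - Y‖ := by
    have h1 := hpB (X - Y) le_rfl
    have h2 := hqJ (X - Y) B le_rfl le_rfl
    have h3 := hqJ (X - Y) (p B X) le_rfl (hpB X (hball X hX))
    have h4 := hqJ Y (p B (X - Y)) (hball Y hY) h1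
    have hsub : Φ X - Φ Y = p B (X - Y) - q (X - Y) (J B) - q (X - Y) (J (p B X))
        - q Y (J (p B (X - Y))) := by
      rw [hΦ, hΦ]
      simp only [map_sub, LinearMap.sub_apply]
      abel
    calc ‖Φ X - Φ Y‖ ≤ ‖p B (X - Y)‖ + ‖q (X - Y) (J B)‖ + ‖q (X - Y) (J (p B X))‖
            + ‖q Y (J (p B (X - Y)))‖ := by
          rw [hsub]
          refine (norm_sub_le _ _).trans ?_
          gcongr
          refine (norm_sub_le _ _).trans ?_
          gcongr
          exact norm_sub_le _ _
      _ ≤ s * ‖X - Y‖ + γ * ‖X - Y‖ * (‖J‖ * ‖B‖)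
            + γ * ‖X - Y‖ * (‖J‖ * (s * (4 * ‖B‖)))
            + γ * (4 * ‖B‖) * (‖J‖ * (s * ‖X - Y‖)) := by gcongr
      _ = (2 * s + 8 * s ^ 2) * ‖X - Y‖ := by rw [hs]; ring
  have hK0 : 0 ≤ 2 * s + 8 * s ^ 2 := by positivity
  have hK1 : 2 * s + 8 * s ^ 2 < 1 := by nlinarith
  have hzero : ‖(0 : M) - B‖ ≤ 3 * ‖B‖ := by
    rw [zero_sub, norm_neg]; linarith
  exact ⟨hmaps, ⟨_, hK0, hK1, hlip⟩,
    exists_unique_fixedPoint_of_contracting_ball hmaps hK0 hK1 hlip hzero⟩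
end

section
/- Let c ≥ 1 be a real number and let j be a nonzero integer. Set v = 1/(c(4j²c² − 1)), D = (1 − 2cv)² − v²/j², y = −4cj² + (2j²/v)(1 − √D), and x = (i·v/(2j))·y + 2cj·i·v (as complex numbers). Then: (a) D = 1 − 1/(c²j²), and in particular D ≥ 0; (b) y satisfies the quadratic fixed-point equation y = 2cv·y + (v/(4j²))·y² + v; and (c) x = i·j·(1 − √(1 − 1/(c²j²))). -/
open Complex in
/-- explicit fixed-point computations of Section 7: with
v = 1/(c(4j²c²−1)), D = (1−2cv)² − v²/j², y = −4cj² + (2j²/v)(1−√D) and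
x = (iv/(2j))y + 2cjiv one has D = 1 − 1/(c²j²) ≥ 0, the quadratic fixed-point
equation y = 2cvy + (v/(4j²))y² + v, and x = ij(1 − √(1 − 1/(c²j²))). -/
theorem stmt_16
    (c : ℝ) (hc : 1 ≤ c) (j : ℤ) (hj : j ≠ 0)
    (v D y : ℝ) (x : ℂ)
    (hv : v = 1 / (c * (4 * (j : ℝ) ^ 2 * c ^ 2 - 1)))
    (hD : D = (1 - 2 * c * v) ^ 2 - v ^ 2 / (j : ℝ) ^ 2)
    (hy : y = -(4 * c * (j : ℝ) ^ 2) + (2 * (j : ℝ) ^ 2 / v) * (1 - Real.sqrt D))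
    (hx : x = (Complex.I * (v : ℂ) / (2 * (j : ℂ))) * (y : ℂ) +
      2 * (c : ℂ) * (j : ℂ) * Complex.I * (v : ℂ)) :
    (D = 1 - 1 / (c ^ 2 * (j : ℝ) ^ 2) ∧ 0 ≤ D) ∧
    y = 2 * c * v * y + (v / (4 * (j : ℝ) ^ 2)) * y ^ 2 + v ∧
    x = Complex.I * (j : ℂ) *
      ((1 - Real.sqrt (1 - 1 / (c ^ 2 * (j : ℝ) ^ 2)) : ℝ) : ℂ) := by
  have hj1 : (1 : ℝ) ≤ (j : ℝ) ^ 2 := by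
    have : (1 : ℤ) ≤ j ^ 2 := Int.add_one_le_iff.mpr (sq_pos_of_ne_zero hj)
    exact_mod_cast this
  have hjR : (j : ℝ) ≠ 0 := Int.cast_ne_zero.mpr hj
  have hjC : (j : ℂ) ≠ 0 := Int.cast_ne_zero.mpr hj
  have hc0 : c ≠ 0 := by positivity
  have hcj : 1 ≤ c ^ 2 * (j : ℝ) ^ 2 := one_le_mul_of_one_le_of_one_le (one_le_pow₀ hc) hj1
  have ha : 4 * (j : ℝ) ^ 2 * c ^ 2 - 1 ≠ 0 := by nlinarith
  have hv0 : v ≠ 0 := by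
    rw [hv]
    exact one_div_ne_zero (mul_ne_zero hc0 ha)
  have hvC : (v : ℂ) ≠ 0 := Complex.ofReal_ne_zero.mpr hv0
  have hD1 : D = 1 - 1 / (c ^ 2 * (j : ℝ) ^ 2) := by
    have ha' : c ^ 2 * 4 * (j : ℝ) ^ 2 - 1 ≠ 0 := by nlinarith
    rw [hD, hv]
    field_simp
    ring
  have hD0 : 0 ≤ D := by
    rw [hD1, sub_nonneg]
    exact div_le_one_of_le₀ hcj (by positivity)
  refine ⟨⟨hD1, hD0⟩, ?_, ?_⟩
  · have hs : Real.sqrt D ^ 2 = (1 - 2 * c * v) ^ 2 - v ^ 2 / (j : ℝ) ^ 2 := by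
      rw [Real.sq_sqrt hD0, hD]
    rw [hy]
    generalize Real.sqrt D = s at hs
    field_simp at hs ⊢
    linear_combination -4 * hs
  · rw [← hD1, hx, hy]
    push_cast
    field_simp
    ring
end

section
/- Let c ≥ 1 be a real number, let j be a nonzero integer, and set μ = i·j·√(1 − 1/(c²j²)) ∈ ℂ. Define x ∈ ℓ²(ℤ, ℂ) by x_j = 1/c, x_{−j} = i·j − μ, and x_k = 0 for k ∉ {j, −j}. Then x ≠ 0 and for every k ∈ ℤ one has i·k·x_k − (1/c)·x_{−k} = μ·x_k; that is, μ is an eigenvalue of the operator (Lx)_k = i·k·x_k − (1/c)·x_{−k} on ℓ²(ℤ, ℂ). -/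
/-- point spectrum of the example of Section 7: for c ≥ 1 and j ≠ 0,
μ = ij√(1 − 1/(c²j²)) is an eigenvalue of (Lx)_k = ik·x_k − (1/c)·x_{−k} on ℓ²(ℤ,ℂ),
with eigenvector x given by x_j = 1/c, x_{−j} = ij − μ, and x_k = 0 otherwise. -/
theorem stmt_17
    (c : ℝ) (hc : 1 ≤ c) (j : ℤ) (hj : j ≠ 0)
    (μ : ℂ)
    (hμ : μ = Complex.I * (j : ℂ) * ((Real.sqrt (1 - 1 / (c ^ 2 * (j : ℝ) ^ 2)) : ℝ) : ℂ))
    (x : ℤ → ℂ)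
    (hxj : x j = 1 / (c : ℂ))
    (hxmj : x (-j) = Complex.I * (j : ℂ) - μ)
    (hx0 : ∀ k : ℤ, k ≠ j → k ≠ -j → x k = 0) :
    Memℓp x 2 ∧ x ≠ 0 ∧
    ∀ k : ℤ, Complex.I * (k : ℂ) * x k - (1 / (c : ℂ)) * x (-k) = μ * x k := by
  have hc0 : c ≠ 0 := by positivity
  have hcC : (c : ℂ) ≠ 0 := by exact_mod_cast hc0
  have hj2 : (1 : ℝ) ≤ (j : ℝ) ^ 2 := by
    exact_mod_cast Int.add_one_le_iff.mpr (sq_pos_of_ne_zero hj)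
  have hrad : 0 ≤ 1 - 1 / (c ^ 2 * (j : ℝ) ^ 2) := by
    have hprod : 1 ≤ c ^ 2 * (j : ℝ) ^ 2 := one_le_mul_of_one_le_of_one_le (one_le_pow₀ hc) hj2
    rw [sub_nonneg]
    exact div_le_one_of_le₀ hprod (by positivity)
  have hsq : μ ^ 2 = 1 / (c : ℂ) ^ 2 - (j : ℂ) ^ 2 := by
    have hjC : (j : ℂ) ≠ 0 := by exact_mod_cast hj
    rw [hμ, mul_pow, mul_pow, Complex.I_sq, ← Complex.ofReal_pow, Real.sq_sqrt hrad]
    push_cast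
    field_simp
    ring
  refine ⟨?_, ?_, fun k => ?_⟩
  · have hfin : {k | x k ≠ 0}.Finite := by
      refine (Set.toFinite {j, -j}).subset fun k hk => ?_
      by_contra hmem
      simp only [Set.mem_insert_iff, Set.mem_singleton_iff, not_or] at hmem
      exact hk (hx0 k hmem.1 hmem.2)
    exact (memℓp_zero hfin).of_exponent_ge zero_le
  · intro hx
    rw [hx, Pi.zero_apply] at hxj
    exact one_div_ne_zero hcC hxj.symm
  · by_cases hkj : k = j
    · subst hkj
      rw [hxj, hxmj]
      ring
    by_cases hkmj : k = -j
    · subst hkmj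
      rw [neg_neg, hxj, hxmj]
      push_cast
      linear_combination hsq - (j : ℂ) ^ 2 * Complex.I_sq
    · rw [hx0 k hkj hkmj, hx0 (-k) (by omega) (by omega)]
      ring
end
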